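/- Let A_S be an irreducible Artin-Tits group of spherical type (i.e., the Coxeter group W_S is finite and the Coxeter graph Γ_S is connected) and let X be a nonempty proper subset of S. Then the standard parabolic subgroup A_X is conjugacy stable in A_S if and only if the pair (W_X, W_S) satisfies Property ⋆_W. -/

import Mathlib

namespace ArtinTits

variable {B : Type*}

/-- The alternating product `a b a b ⋯` with `m` factors, starting with `a`. -/
def altProd {G : Type*} [Monoid G] (a b : G) : ℕ → G
  | 0 => 1
  | n + 1 => a * altProd b a n

/-- The braid relations defining the Artin–Tits group of a Coxeter matrix:
`Π(σ_s, σ_t; m_{s,t}) = Π(σ_t, σ_s; m_{s,t})` whenever `m_{s,t} ≠ ∞` (here `∞` is coded by `0`). -/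
def artinRelationsSet (M : CoxeterMatrix B) : Set (FreeGroup B) :=
  {r | ∃ s t : B, M s t ≠ 0 ∧
    r = altProd (FreeGroup.of s) (FreeGroup.of t) (M s t) *
        (altProd (FreeGroup.of t) (FreeGroup.of s) (M s t))⁻¹}

/-- The Artin–Tits group of a Coxeter matrix. -/
abbrev ArtinGroup (M : CoxeterMatrix B) : Type _ := PresentedGroup (artinRelationsSet M)

/-- The standard generator `σ_s` of the Artin–Tits group. -/
def σ (M : CoxeterMatrix B) (s : B) : ArtinGroup M := PresentedGroup.of s

/-- The standard parabolic subgroup `A_X` of the Artin–Tits group. -/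
def AP (M : CoxeterMatrix B) (X : Set B) : Subgroup (ArtinGroup M) :=
  Subgroup.closure (σ M '' X)

/-- The standard parabolic subgroup `W_X` of the Coxeter group. -/
def WP (M : CoxeterMatrix B) (X : Set B) : Subgroup M.Group :=
  Subgroup.closure (M.simple '' X)

/-- A subgroup `H ≤ G` is conjugacy stable if any two elements of `H` which are conjugate
in `G` are already conjugate by an element of `H`. -/
def IsConjugacyStable {G : Type*} [Group G] (H : Subgroup G) : Prop :=
  ∀ a b : G, a ∈ H → b ∈ H → (∃ g : G, g⁻¹ * a * g = b) → ∃ h ∈ H, h⁻¹ * a * h = b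

/-- Property `⋆_W` for the pair `(W_X, W_S)`. -/
def StarW (M : CoxeterMatrix B) (X : Set B) : Prop :=
  ∀ Y₁ Y₂ : Set B, Y₁ ⊆ X → Y₂ ⊆ X → ∀ w : M.Group,
    (fun x => w⁻¹ * x * w) '' (M.simple '' Y₁) = M.simple '' Y₂ →
    ∃ v ∈ WP M X, ∀ y ∈ Y₁, v⁻¹ * M.simple y * v = w⁻¹ * M.simple y * w

/-- Property `⋆_A` for the pair `(A_X, A_S)`. -/
def StarA (M : CoxeterMatrix B) (X : Set B) : Prop :=
  ∀ Y₁ Y₂ : Set B, Y₁ ⊆ X → Y₂ ⊆ X → ∀ g : ArtinGroup M,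
    (fun x => g⁻¹ * x * g) '' (σ M '' Y₁) = σ M '' Y₂ →
    ∃ h ∈ AP M X, ∀ y ∈ Y₁, h⁻¹ * σ M y * h = g⁻¹ * σ M y * g

/-- Adjacency in the Coxeter graph: `s` and `t` are joined by an edge iff `m_{s,t} ≥ 3`
(where the value `0` codes `∞`, which also gives an edge). -/
def Adj (M : CoxeterMatrix B) (s t : B) : Prop := s ≠ t ∧ M s t ≠ 2

/-- `s` and `t` are connected by a path of the Coxeter graph staying inside `X`. -/
def ReachIn (M : CoxeterMatrix B) (X : Set B) (s t : B) : Prop :=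
  Relation.ReflTransGen (fun a b => a ∈ X ∧ b ∈ X ∧ Adj M a b) s t

/-- The Coxeter graph induced on `X` is connected. -/
def ConnectedIn (M : CoxeterMatrix B) (X : Set B) : Prop :=
  ∀ s ∈ X, ∀ t ∈ X, ReachIn M X s t

/-- The Coxeter matrix `M` restricted to `X` is of the type of the Coxeter matrix `M'`,
i.e. there is a bijection transporting one to the other. -/
def IsOfType {B' : Type*} (M : CoxeterMatrix B) (X : Set B) (M' : CoxeterMatrix B') : Prop :=
  ∃ e : X ≃ B', ∀ a b : X, M a.val b.val = M' (e a) (e b)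

/-- The Coxeter matrix of type `Bₙ` with the paper's labelling: vertices `0, …, n-1`
(representing `s_1, …, s_n`), `m_{s_1, s_2} = 4` and `m_{s_i, s_{i+1}} = 3` for `i ≥ 2`. -/
def Bmat (n : ℕ) : CoxeterMatrix (Fin n) where
  M := Matrix.of fun i j : Fin n ↦
    if i = j then 1
      else (if (i.val = 0 ∧ j.val = 1) ∨ (j.val = 0 ∧ i.val = 1) then 4
        else (if (j : ℕ) + 1 = i ∨ (i : ℕ) + 1 = j then 3 else 2))
  isSymm := by unfold Matrix.IsSymm; aesop
  diagonal := by simp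
  off_diagonal := by aesop

/-- The Coxeter matrix of type `Dₙ` with the paper's labelling: vertices `0, …, n-1`
(representing `s_1, …, s_n`), with edges `{s_1, s_3}`, `{s_2, s_3}` and `{s_i, s_{i+1}}`
for `i ≥ 3`, all labelled `3`. -/
def Dmat (n : ℕ) : CoxeterMatrix (Fin n) where
  M := Matrix.of fun i j : Fin n ↦
    if i = j then 1
      else (if (i.val = 0 ∧ j.val = 2) ∨ (j.val = 0 ∧ i.val = 2) then 3
        else (if i.val = 0 ∨ j.val = 0 then 2
          else (if (j : ℕ) + 1 = i ∨ (i : ℕ) + 1 = j then 3 else 2)))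
  isSymm := by unfold Matrix.IsSymm; aesop
  diagonal := by simp
  off_diagonal := by aesop

end ArtinTits

namespace ArtinTits

section Geometric
variable {B : Type*} (M : CoxeterMatrix B)
open Polynomial.Chebyshev Module

noncomputable def geoF (i : B) : Module.Dual ℝ (B →₀ ℝ) :=
  Finsupp.lsum ℝ fun j => LinearMap.toSpanSingleton ℝ ℝ (-2 * Real.cos (Real.pi / M i j))

lemma geoF_single (i j : B) :
    geoF M i (Finsupp.single j 1) = -2 * Real.cos (Real.pi / M i j) := by
  simp [geoF]

lemma geoF_self (i : B) : geoF M i (Finsupp.single i 1) = 2 := by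
  simp [geoF_single]

noncomputable def geoR (i : B) : (B →₀ ℝ) ≃ₗ[ℝ] (B →₀ ℝ) :=
  Module.reflection (geoF_self M i)

lemma geo_t (i j : B) : (2 * Real.cos (2 * (Real.pi / M i j))) =
    geoF M i (Finsupp.single j 1) * geoF M j (Finsupp.single i 1) - 2 := by
  rw [geoF_single, geoF_single, M.symmetric j i, Real.cos_two_mul]; ring

lemma geo_sin_ne {m : ℕ} (hm : 3 ≤ m) : Real.sin (2 * (Real.pi / m)) ≠ 0 := by
  apply ne_of_gt
  have hm' : (3:ℝ) ≤ m := by exact_mod_cast hm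
  have := Real.pi_pos
  apply Real.sin_pos_of_pos_of_lt_pi
  · positivity
  · rw [mul_div_assoc', div_lt_iff₀ (by linarith)]; nlinarith

lemma geoR_sq (i : B) : geoR M i * geoR M i = 1 := by
  ext1 v
  exact involutive_reflection (geoF_self M i) v

lemma geo_liftable : M.IsLiftable (fun i => geoR M i) := by
  intro i j
  by_cases h0 : M i j = 0
  · rw [h0, pow_zero]
  by_cases hij : i = j
  · subst hij; simp [geoR_sq]
  have h1 : M i j ≠ 1 := M.off_diagonal i j hij
  apply LinearEquiv.toLinearMap_injective
  ext1 k
  ext1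
  simp only [LinearMap.comp_apply, LinearEquiv.coe_coe]
  generalize (Finsupp.lsingle k : ℝ →ₗ[ℝ] _) 1 = z
  have key := reflection_mul_reflection_pow_apply (geoF_self M i) (geoF_self M j) (M i j) z
    (2 * Real.cos (2 * (Real.pi / M i j))) (geo_t M i j)
  refine Eq.trans (b := ((reflection (geoF_self M i) * reflection (geoF_self M j)) ^ M i j) z) rfl (key.trans ?_)
  by_cases h2 : M i j = 2
  · rw [h2]
    simp [geoF_single, h2, M.symmetric j i]
    have : 2 * (Real.pi / 2) = Real.pi := by ring
    rw [this, Real.cos_pi]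
    module
  have h3 : 3 ≤ M i j := by omega
  have hs := geo_sin_ne h3
  set m := M i j with hm
  set θ := 2 * (Real.pi / m) with hθ
  have hS : ∀ n : ℤ, (S ℝ n).eval (2 * Real.cos θ) = Real.sin ((n + 1) * θ) / Real.sin θ := by
    intro n
    rw [eq_div_iff hs, S_two_mul_real_cos]
  have hmθ : (m:ℝ) * θ = 2 * Real.pi := by
    have : (m:ℝ) ≠ 0 := by positivity
    rw [hθ]; field_simp
  rcases Nat.even_or_odd' m with ⟨q, hq | hq⟩
  · have e1 : ((m:ℤ) - 2) / 2 = q - 1 := by omega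
    have e2 : ((m:ℤ) - 1) / 2 = q - 1 := by omega
    have hz : (S ℝ ((q:ℤ) - 1)).eval (2 * Real.cos θ) = 0 := by
      rw [hS]
      have : ((((q:ℤ) - 1 : ℤ) : ℝ) + 1) * θ = Real.pi := by
        push_cast; rw [hq] at hmθ; push_cast at hmθ; linarith
      rw [this]; simp
    rw [e1, e2, hz]; simp
  · have e1 : ((m:ℤ) - 1) / 2 = q := by omega
    have e2 : ((m:ℤ) - 3) / 2 = q - 1 := by omega
    have e3 : ((m:ℤ) - 2) / 2 = q - 1 := by omega
    have e4 : (m:ℤ) / 2 = q := by omega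
    have hz : (S ℝ (q:ℤ)).eval (2 * Real.cos θ) + (S ℝ ((q:ℤ) - 1)).eval (2 * Real.cos θ) = 0 := by
      rw [hS, hS, ← add_div]
      have : (((q:ℤ) : ℝ) + 1) * θ = 2 * Real.pi - ((((q:ℤ) - 1 : ℤ) : ℝ) + 1) * θ := by
        push_cast; rw [hq] at hmθ; push_cast at hmθ; linarith
      rw [this, Real.sin_two_pi_sub]; simp
    rw [e1, e2, e3, e4, hz]; simp

noncomputable def geoRep : M.Group →* ((B →₀ ℝ) ≃ₗ[ℝ] (B →₀ ℝ)) :=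
  M.toCoxeterSystem.lift ⟨fun i => geoR M i, geo_liftable M⟩

lemma geoRep_simple (i : B) : geoRep M (M.simple i) = geoR M i :=
  M.toCoxeterSystem.lift_apply_simple (geo_liftable M) i

theorem order_dvd {i j : B} {k : ℕ} (h : (M.simple i * M.simple j) ^ k = 1) : M i j ∣ k := by
  by_cases hij : i = j
  · subst hij; simp
  have h1 : M i j ≠ 1 := M.off_diagonal i j hij
  have h' := congrArg (geoRep M) h
  rw [map_pow, map_mul, geoRep_simple, geoRep_simple, map_one] at h'
  have key := reflection_mul_reflection_pow_apply_self (geoF_self M i) (geoF_self M j) k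
    (2 * Real.cos (2 * (Real.pi / M i j))) (geo_t M i j)
  have h'' := DFunLike.congr_fun h' (Finsupp.single i 1)
  rw [show (geoR M i * geoR M j) ^ k = (reflection (geoF_self M i) * reflection (geoF_self M j)) ^ k from rfl,
    key] at h''
  have ei := DFunLike.congr_fun h'' i
  have ej := DFunLike.congr_fun h'' j
  simp [hij, Ne.symm hij, geoF_single, M.symmetric j i] at ei ej
  by_cases h0 : M i j = 0
  · rw [h0] at ei ej ⊢
    simp at ej
    simp [ej]
  by_cases h2 : M i j = 2
  · rw [h2] at ei ej ⊢
    have : 2 * (Real.pi / (2:ℕ)) = Real.pi := by push_cast; ring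
    rw [this] at ei ej
    simp [S_eval_neg_two] at ei
    rcases Nat.even_or_odd' k with ⟨q, hq | hq⟩
    · exact ⟨q, hq⟩
    · exfalso
      have e : ((k:ℤ) - 1).natAbs = 2 * q := by omega
      rw [e, hq, pow_succ, pow_mul] at ei
      norm_num at ei
      linarith
  have h3 : 3 ≤ M i j := by omega
  have hs := geo_sin_ne h3
  set m := M i j with hm
  have hc : Real.cos (Real.pi / m) ≠ 0 := by
    intro h
    apply hs
    rw [Real.sin_two_mul, h]; simp
  simp [hc] at ej
  rw [ej, add_zero] at ei
  set θ := 2 * (Real.pi / m) with hθ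
  have hS : ∀ n : ℤ, (S ℝ n).eval (2 * Real.cos θ) = Real.sin ((n + 1) * θ) / Real.sin θ := by
    intro n
    rw [eq_div_iff hs, S_two_mul_real_cos]
  rw [hS, div_eq_iff hs] at ei ej
  push_cast at ei ej
  rw [sub_add_cancel] at ej
  rw [zero_mul] at ej
  rw [add_mul, one_mul, Real.sin_add, ej, one_mul, zero_mul, zero_add] at ei
  have hcos : Real.cos (k * θ) = 1 := by
    have := mul_right_cancel₀ hs (ei.trans (one_mul _).symm); exact this
  rw [Real.cos_eq_one_iff] at hcos
  obtain ⟨n, hn⟩ := hcos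
  have hm0 : (m:ℝ) ≠ 0 := by positivity
  have : (n:ℝ) * m = k := by
    have := Real.pi_pos
    rw [hθ] at hn
    field_simp at hn
    linarith
  have h4 : n * (m:ℤ) = k := by exact_mod_cast this
  have : (m:ℤ) ∣ k := ⟨n, by rw [← h4]; ring⟩
  exact_mod_cast this

theorem simple_inj {i j : B} (h : M.simple i = M.simple j) : i = j := by
  have : (M.simple i * M.simple j) ^ 1 = 1 := by
    rw [h, pow_one]; exact M.toCoxeterSystem.simple_mul_simple_self j
  have h1 := order_dvd M this
  by_contra hij
  exact M.off_diagonal i j hij (Nat.dvd_one.mp h1)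

end Geometric
end ArtinTits

namespace ArtinTits

section AltProd

lemma altProd_zero {G : Type*} [Monoid G] (a b : G) : altProd a b 0 = 1 := rfl

lemma altProd_succ {G : Type*} [Monoid G] (a b : G) (n : ℕ) :
    altProd a b (n + 1) = a * altProd b a n := rfl

lemma map_altProd {G H : Type*} [Monoid G] [Monoid H] (φ : G →* H) (a b : G) (n : ℕ) :
    φ (altProd a b n) = altProd (φ a) (φ b) n := by
  induction n generalizing a b with
  | zero => simp [altProd_zero]
  | succ n ih => simp [altProd_succ, ih]

lemma altProd_mul_inv {G : Type*} [Group G] (a b : G) (ha : a * a = 1) (hb : b * b = 1) (n : ℕ) :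
    altProd a b n * (altProd b a n)⁻¹ = (a * b) ^ n := by
  induction n generalizing a b with
  | zero => simp [altProd_zero]
  | succ n ih =>
    have hb' : b⁻¹ = b := inv_eq_of_mul_eq_one_left hb
    rw [altProd_succ, altProd_succ, mul_inv_rev, hb']
    have h1 := ih b a hb ha
    calc a * altProd b a n * ((altProd a b n)⁻¹ * b)
        = a * (altProd b a n * (altProd a b n)⁻¹) * b := by group
      _ = a * (b * a) ^ n * b := by rw [h1]
      _ = (a * b) ^ (n + 1) := by
        rw [← mul_pow_mul, pow_succ, mul_assoc]

lemma altProd_eq_of_pow {G : Type*} [Group G] {a b : G} (ha : a * a = 1) (hb : b * b = 1) {n : ℕ}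
    (h : (a * b) ^ n = 1) : altProd a b n = altProd b a n := by
  have := altProd_mul_inv a b ha hb n
  rw [h] at this
  exact mul_inv_eq_one.mp this

lemma altProd_add {G : Type*} [Monoid G] (a b : G) (n j : ℕ) :
    altProd a b (n + j) = altProd a b n * (if Even n then altProd a b j else altProd b a j) := by
  induction n generalizing a b with
  | zero => simp [altProd_zero]
  | succ n ih =>
    rw [show n + 1 + j = (n + j) + 1 by ring, altProd_succ, altProd_succ, ih, mul_assoc]
    by_cases h : Even n <;> simp [h, Nat.even_add_one]

end AltProd

section Cocycle
open Classical in
/-- conjugation action on functions -/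
noncomputable def cact {W K : Type*} [Group W] (u : W) (f : W → K) : W → K :=
  fun x => f (u⁻¹ * x * u)

lemma cact_one {W K : Type*} [Group W] (f : W → K) : cact (1 : W) f = f := by
  funext x; simp [cact]

lemma cact_mul {W K : Type*} [Group W] (u v : W) (f : W → K) :
    cact (u * v) f = cact u (cact v f) := by
  funext x; simp [cact, mul_assoc]

lemma cact_add {W K : Type*} [Group W] [Add K] (u : W) (f g : W → K) :
    cact u (f + g) = cact u f + cact u g := rfl

lemma cact_zero {W K : Type*} [Group W] [Zero K] (u : W) :
    cact u (0 : W → K) = 0 := rfl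

lemma cact_sum {W K ι : Type*} [Group W] [AddCommMonoid K] (u : W) (s : Finset ι) (f : ι → W → K) :
    cact u (∑ i ∈ s, f i) = ∑ i ∈ s, cact u (f i) := by
  funext x; simp [cact]

open Classical in
noncomputable def delta {W : Type*} (K : Type*) [Ring K] (u : W) : W → K :=
  fun x => if x = u then 1 else 0

lemma cact_delta {W K : Type*} [Group W] [Ring K] (u v : W) :
    cact u (delta K v) = delta K (u * v * u⁻¹) := by
  funext x
  have : u⁻¹ * x * u = v ↔ x = u * v * u⁻¹ := by
    constructor
    · rintro rfl; group
    · rintro rfl; group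
  simp only [cact, delta]
  by_cases h : x = u * v * u⁻¹
  · rw [if_pos (this.2 h), if_pos h]
  · rw [if_neg (fun h' => h (this.1 h')), if_neg h]

noncomputable def rho {W : Type*} (K : Type*) [Group W] [Ring K] (u : W) : Equiv.Perm (W → K) where
  toFun f := delta K u + cact u f
  invFun f := cact u⁻¹ (f - delta K u)
  left_inv f := by
    show cact u⁻¹ (delta K u + cact u f - delta K u) = f
    rw [add_sub_cancel_left, ← cact_mul]; simp [cact_one]
  right_inv f := by
    show delta K u + cact u (cact u⁻¹ (f - delta K u)) = f
    rw [← cact_mul]; simp [cact_one]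

lemma rho_apply {W K : Type*} [Group W] [Ring K] (u : W) (f : W → K) :
    rho K u f = delta K u + cact u f := rfl

lemma altProd_rho {W K : Type*} [Group W] [Ring K] (a b : W) (ha : a * a = 1) (hb : b * b = 1)
    (n : ℕ) (f : W → K) : altProd (rho K a) (rho K b) n f =
      ∑ i ∈ Finset.range n, delta K ((a * b) ^ i * a) + cact (altProd a b n) f := by
  induction n generalizing a b with
  | zero => simp [altProd_zero, cact_one]
  | succ n ih =>
    have ha' : a⁻¹ = a := inv_eq_of_mul_eq_one_left ha
    rw [altProd_succ, altProd_succ, Equiv.Perm.mul_apply, ih b a hb ha, rho_apply, cact_add,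
      cact_mul, Finset.sum_range_succ', cact_sum]
    simp only [cact_delta, ha']
    have : ∀ i, a * ((b * a) ^ i * b) * a = (a * b) ^ (i + 1) * a := by
      intro i
      rw [pow_succ, ← mul_assoc a, ← mul_pow_mul, mul_assoc (_ ^ i) a b]
    simp only [this]
    simp
    abel

lemma braid_rho {W K : Type*} [Group W] [Ring K] (a b : W) (ha : a * a = 1) (hb : b * b = 1)
    {n : ℕ} (h : (a * b) ^ n = 1) :
    altProd (rho K a) (rho K b) n = altProd (rho K b) (rho K a) n := by
  ext1 f
  rw [altProd_rho a b ha hb, altProd_rho b a hb ha, altProd_eq_of_pow ha hb h]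
  congr 1
  rw [← Finset.sum_range_reflect]
  apply Finset.sum_congr rfl
  intro i hi
  rw [Finset.mem_range] at hi
  congr 1
  have ha' : a⁻¹ = a := inv_eq_of_mul_eq_one_left ha
  have hb' : b⁻¹ = b := inv_eq_of_mul_eq_one_left hb
  have h2 : b * a = (a * b)⁻¹ := by rw [mul_inv_rev, ha', hb']
  have h3 : (a * b) ^ (n - 1 - i) * (a * b) * (a * b) ^ i = 1 := by
    rw [← pow_succ, ← pow_add, show n - 1 - i + 1 + i = n by omega, h]
  rw [h2, inv_pow]
  rw [eq_comm, inv_mul_eq_iff_eq_mul]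
  have h4 : (a * b) ^ i * ((a * b) ^ (n - 1 - i) * (a * b)) = 1 := by
    rw [← pow_succ, ← pow_add, show i + (n - 1 - i + 1) = n by omega, h]
  calc b = ((a * b) ^ i * ((a * b) ^ (n - 1 - i) * (a * b))) * b := by rw [h4, one_mul]
    _ = (a * b) ^ i * ((a * b) ^ (n - 1 - i) * a) * (b * b) := by group
    _ = _ := by rw [hb, mul_one]

end Cocycle

section Lift
variable {B : Type*} (M : CoxeterMatrix B)

lemma sim_mul_self (i : B) : M.simple i * M.simple i = 1 :=
  M.toCoxeterSystem.simple_mul_simple_self i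

lemma sim_inv (i : B) : (M.simple i)⁻¹ = M.simple i :=
  M.toCoxeterSystem.inv_simple i

lemma sim_pow (i j : B) : (M.simple i * M.simple j) ^ M i j = 1 :=
  M.toCoxeterSystem.simple_mul_simple_pow i j

lemma artin_braid (s t : B) (h : M s t ≠ 0) :
    altProd (σ M s) (σ M t) (M s t) = altProd (σ M t) (σ M s) (M s t) := by
  have := PresentedGroup.one_of_mem (rels := artinRelationsSet M) ⟨s, t, h, rfl⟩
  rw [map_mul, map_inv, map_altProd, map_altProd] at this
  exact mul_inv_eq_one.mp this

noncomputable def artinLift {G : Type*} [Group G] (f : B → G)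
    (h : ∀ s t, M s t ≠ 0 → altProd (f s) (f t) (M s t) = altProd (f t) (f s) (M s t)) :
    ArtinGroup M →* G :=
  PresentedGroup.toGroup (f := f) (by
    rintro r ⟨s, t, hst, rfl⟩
    rw [map_mul, map_inv, map_altProd, map_altProd, mul_inv_eq_one]
    simpa using h s t hst)

lemma artinLift_σ {G : Type*} [Group G] (f : B → G) (h) (s : B) :
    artinLift M f h (σ M s) = f s := by
  simp [artinLift, σ]

/-- the projection from the Artin group to the Coxeter group -/
noncomputable def pr : ArtinGroup M →* M.Group :=
  artinLift M M.simple (fun s t _ =>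
    altProd_eq_of_pow (sim_mul_self M s) (sim_mul_self M t) (sim_pow M s t))

lemma pr_σ (s : B) : pr M (σ M s) = M.simple s := artinLift_σ M _ _ s

lemma closure_σ : Subgroup.closure (Set.range (σ M)) = ⊤ := PresentedGroup.closure_range_of _

lemma artin_induction {p : ArtinGroup M → Prop} (g : ArtinGroup M) (one : p 1)
    (mul : ∀ s g, p g → p (σ M s * g)) (inv : ∀ s g, p g → p ((σ M s)⁻¹ * g)) : p g := by
  have hg : g ∈ Subgroup.closure (Set.range (σ M)) := by rw [closure_σ]; trivial
  induction hg using Subgroup.closure_induction_left with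
  | one => exact one
  | mul_left x hx y _ ih => obtain ⟨s, rfl⟩ := hx; exact mul s y ih
  | inv_mul_cancel x hx y _ ih => obtain ⟨s, rfl⟩ := hx; exact inv s y ih

noncomputable def linkA : ArtinGroup M →* Equiv.Perm (M.Group → ℤ) :=
  artinLift M (fun s => rho ℤ (M.simple s)) (fun s t _ =>
    braid_rho _ _ (sim_mul_self M s) (sim_mul_self M t) (sim_pow M s t))

lemma linkA_apply (g : ArtinGroup M) (f : M.Group → ℤ) :
    linkA M g f = linkA M g 0 + cact (pr M g) f := by
  induction g using artin_induction M generalizing f with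
  | one => simp [cact_one]
  | mul s g ih =>
    rw [map_mul, map_mul, Equiv.Perm.mul_apply, Equiv.Perm.mul_apply, ih, pr_σ, linkA,
      artinLift_σ, rho_apply, rho_apply, cact_mul, cact_add, add_assoc]
  | inv s g ih =>
    have hinv : ∀ f : M.Group → ℤ, (rho ℤ (M.simple s))⁻¹ f =
      cact (M.simple s)⁻¹ (f - delta ℤ (M.simple s)) := fun _ => rfl
    rw [map_mul, map_mul, Equiv.Perm.mul_apply, Equiv.Perm.mul_apply, ih, map_inv, map_inv,
      pr_σ, linkA, artinLift_σ, cact_mul, hinv, hinv, ← cact_add]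
    congr 1
    abel

/-- abelianised linking cocycle -/
noncomputable def lk (g : ArtinGroup M) : M.Group → ℤ := linkA M g 0

lemma lk_mul (g h : ArtinGroup M) : lk M (g * h) = lk M g + cact (pr M g) (lk M h) := by
  rw [lk, map_mul, Equiv.Perm.mul_apply, linkA_apply]; rfl

lemma lk_σ (s : B) : lk M (σ M s) = delta ℤ (M.simple s) := by
  rw [lk, linkA, artinLift_σ, rho_apply, cact_zero, add_zero]

lemma rho_sq {W : Type*} [Group W] (u : W) (hu : u * u = 1) :
    rho (ZMod 2) u * rho (ZMod 2) u = 1 := by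
  ext1 f
  rw [Equiv.Perm.mul_apply, rho_apply, rho_apply, cact_add, ← cact_mul, hu, cact_one, cact_delta,
    mul_inv_cancel_right, ← add_assoc]
  funext x
  simp [delta]
  split_ifs
  · have : (1 + 1 : ZMod 2) = 0 := by decide
    exact this
  · simp

noncomputable def linkW : M.Group →* Equiv.Perm (M.Group → ZMod 2) :=
  M.toCoxeterSystem.lift ⟨fun s => rho (ZMod 2) (M.simple s), fun s t => by
    rw [← altProd_mul_inv _ _ (rho_sq _ (sim_mul_self M s)) (rho_sq _ (sim_mul_self M t)),
      mul_inv_eq_one]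
    exact braid_rho _ _ (sim_mul_self M s) (sim_mul_self M t) (sim_pow M s t)⟩

lemma linkW_simple (s : B) : linkW M (M.simple s) = rho (ZMod 2) (M.simple s) :=
  M.toCoxeterSystem.lift_apply_simple _ s

lemma linkW_apply (w : M.Group) (f : M.Group → ZMod 2) :
    linkW M w f = linkW M w 0 + cact w f := by
  induction w using M.toCoxeterSystem.simple_induction_left generalizing f with
  | one => simp [cact_one]
  | mul_simple_left w s ih =>
    rw [CoxeterMatrix.toCoxeterSystem_simple,
      map_mul, Equiv.Perm.mul_apply, Equiv.Perm.mul_apply, ih, linkW_simple,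
      rho_apply, rho_apply, cact_mul, cact_add, add_assoc]

/-- the inversion set of `w`, as a `ZMod 2`-valued function -/
noncomputable def NN (w : M.Group) : M.Group → ZMod 2 := linkW M w 0

lemma NN_one : NN M 1 = 0 := by simp [NN]

lemma NN_mul (g h : M.Group) : NN M (g * h) = NN M g + cact g (NN M h) := by
  rw [NN, map_mul, Equiv.Perm.mul_apply, linkW_apply]; rfl

lemma NN_simple (s : B) : NN M (M.simple s) = delta (ZMod 2) (M.simple s) := by
  rw [NN, linkW_simple, rho_apply, cact_zero, add_zero]

end Lift
end ArtinTits

namespace ArtinTits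
section Len
variable {B : Type*} (M : CoxeterMatrix B)

noncomputable def len (w : M.Group) : ℕ := M.toCoxeterSystem.length w

/-- product of a word in the simple reflections -/
def wp (ω : List B) : M.Group := (ω.map M.simple).prod

lemma wp_nil : wp M [] = 1 := rfl
lemma wp_cons (s : B) (ω : List B) : wp M (s :: ω) = M.simple s * wp M ω := by simp [wp]
lemma wp_append (ω ω' : List B) : wp M (ω ++ ω') = wp M ω * wp M ω' := by simp [wp]

lemma len_wp_le (ω : List B) : len M (wp M ω) ≤ ω.length := M.toCoxeterSystem.length_wordProd_le ω

lemma exists_word (w : M.Group) : ∃ ω : List B, ω.length = len M w ∧ wp M ω = w := by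
  obtain ⟨ω, h1, h2⟩ := M.toCoxeterSystem.exists_isReduced w
  refine ⟨ω, ?_, h2.symm⟩
  rw [h2]; exact h1.eq.symm

lemma len_one : len M 1 = 0 := M.toCoxeterSystem.length_one
lemma len_eq_zero {w : M.Group} : len M w = 0 ↔ w = 1 := M.toCoxeterSystem.length_eq_zero_iff
lemma len_inv (w : M.Group) : len M w⁻¹ = len M w := M.toCoxeterSystem.length_inv w
lemma len_mul_le (u v : M.Group) : len M (u * v) ≤ len M u + len M v :=
  M.toCoxeterSystem.length_mul_le u v
lemma len_simple (s : B) : len M (M.simple s) = 1 := M.toCoxeterSystem.length_simple s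
lemma len_simple_mul (s : B) (w : M.Group) :
    len M (M.simple s * w) = len M w + 1 ∨ len M (M.simple s * w) + 1 = len M w :=
  M.toCoxeterSystem.length_simple_mul w s
lemma len_mul_simple (w : M.Group) (s : B) :
    len M (w * M.simple s) = len M w + 1 ∨ len M (w * M.simple s) + 1 = len M w :=
  M.toCoxeterSystem.length_mul_simple w s

lemma sim_cancel (s : B) (w : M.Group) : M.simple s * (M.simple s * w) = w := by
  rw [← mul_assoc, sim_mul_self, one_mul]

lemma sim_cancel_right (s : B) (w : M.Group) : w * M.simple s * M.simple s = w := by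
  rw [mul_assoc, sim_mul_self, mul_one]

/-- `NN` on a product with simple on the left. -/
lemma NN_simple_mul (s : B) (w t : M.Group) : NN M (M.simple s * w) t =
    delta (ZMod 2) (M.simple s) t + NN M w (M.simple s * t * M.simple s) := by
  rw [NN_mul, NN_simple, Pi.add_apply, cact, sim_inv]

lemma delta_self {W K : Type*} [Ring K] (u : W) : delta K u u = 1 := by simp [delta]
lemma delta_ne {W K : Type*} [Ring K] {u v : W} (h : v ≠ u) : delta K u v = 0 := by simp [delta, h]

/-- strong exchange -/
lemma exchange_word (ω : List B) (t : M.Group) (h : NN M (wp M ω) t ≠ 0) :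
    ∃ ω' : List B, ω'.Sublist ω ∧ ω'.length + 1 = ω.length ∧ wp M ω' = t * wp M ω := by
  induction ω generalizing t with
  | nil => simp [wp_nil, NN_one] at h
  | cons s ω ih =>
    rw [wp_cons, NN_simple_mul] at h
    by_cases ht : t = M.simple s
    · refine ⟨ω, List.sublist_cons_self s ω, rfl, ?_⟩
      rw [ht, wp_cons, sim_cancel]
    · rw [delta_ne ht, zero_add] at h
      obtain ⟨ω', h1, h2, h3⟩ := ih _ h
      refine ⟨s :: ω', h1.cons_cons s, by simp [h2], ?_⟩
      rw [wp_cons, wp_cons, h3, mul_assoc, mul_assoc, sim_cancel]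

lemma len_lt_of_NN {w t : M.Group} (h : NN M w t ≠ 0) : len M (t * w) < len M w := by
  obtain ⟨ω, h1, rfl⟩ := exists_word M w
  obtain ⟨ω', _, h3, h4⟩ := exchange_word M ω t h
  rw [← h4]
  have := len_wp_le M ω'
  omega

lemma NN_ne_iff (s : B) (w : M.Group) :
    NN M w (M.simple s) ≠ 0 ↔ len M (M.simple s * w) + 1 = len M w := by
  constructor
  · intro h
    have := len_lt_of_NN M h
    rcases len_simple_mul M s w with h | h <;> omega
  · intro h h0
    have h1 := NN_simple_mul M s w (M.simple s)
    rw [delta_self, sim_mul_self, one_mul, h0, add_zero] at h1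
    have := len_lt_of_NN M (w := M.simple s * w) (t := M.simple s) (by rw [h1]; decide)
    rw [sim_cancel] at this
    omega

lemma NN_eq_zero_iff (s : B) (w : M.Group) :
    NN M w (M.simple s) = 0 ↔ len M (M.simple s * w) = len M w + 1 := by
  have h := NN_ne_iff M s w
  rcases len_simple_mul M s w with h1 | h1
  · simp only [h1, iff_true]
    by_contra h2
    have := h.1 h2; omega
  · constructor
    · intro h0; exact absurd h0 (h.2 h1)
    · intro h2; omega

lemma zmod2_cases (x : ZMod 2) (h : x ≠ 0) : x = 1 := by
  revert x; decide

/-- every word has a reduced subword with the same product -/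
lemma reduced_sublist (ω : List B) :
    ∃ ω' : List B, ω'.Sublist ω ∧ ω'.length = len M (wp M ω) ∧ wp M ω' = wp M ω := by
  induction ω with
  | nil => exact ⟨[], List.Sublist.refl _, by simp [wp_nil, len_one], rfl⟩
  | cons s ω ih =>
    obtain ⟨ω', h1, h2, h3⟩ := ih
    rw [wp_cons]
    rcases len_simple_mul M s (wp M ω) with h | h
    · exact ⟨s :: ω', h1.cons_cons s, by simp [h, h2], by rw [wp_cons, h3]⟩
    · have h4 := (NN_ne_iff M s (wp M ω)).2 h
      rw [← h3] at h4
      obtain ⟨ω'', h5, h6, h7⟩ := exchange_word M ω' _ h4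
      refine ⟨ω'', (h5.trans h1).trans (List.sublist_cons_self s ω), by omega, by rw [h7, h3]⟩

lemma simple_mem_WP {X : Set B} {x : B} (hx : x ∈ X) : M.simple x ∈ WP M X :=
  Subgroup.subset_closure ⟨x, hx, rfl⟩

lemma wp_mem_WP {X : Set B} (ω : List B) (h : ∀ x ∈ ω, x ∈ X) : wp M ω ∈ WP M X := by
  induction ω with
  | nil => exact one_mem _
  | cons s ω ih =>
    rw [wp_cons]
    exact mul_mem (simple_mem_WP M (h s (by simp))) (ih fun x hx => h x (by simp [hx]))

lemma WP_word {X : Set B} {w : M.Group} (hw : w ∈ WP M X) :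
    ∃ ω : List B, (∀ x ∈ ω, x ∈ X) ∧ ω.length = len M w ∧ wp M ω = w := by
  have : ∃ ω : List B, (∀ x ∈ ω, x ∈ X) ∧ wp M ω = w := by
    induction hw using Subgroup.closure_induction_left with
    | one => exact ⟨[], by simp, rfl⟩
    | mul_left x hx y _ ih =>
      obtain ⟨s, hs, rfl⟩ := hx
      obtain ⟨ω, h1, rfl⟩ := ih
      exact ⟨s :: ω, by simpa [hs] using h1, wp_cons M s ω⟩
    | inv_mul_cancel x hx y _ ih =>
      obtain ⟨s, hs, rfl⟩ := hx
      obtain ⟨ω, h1, rfl⟩ := ih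
      exact ⟨s :: ω, by simpa [hs] using h1, by rw [sim_inv]; exact wp_cons M s ω⟩
  obtain ⟨ω, h1, rfl⟩ := this
  obtain ⟨ω', h2, h3, h4⟩ := reduced_sublist M ω
  exact ⟨ω', fun x hx => h1 x (h2.subset hx), h3, h4⟩

lemma WP_induction {X : Set B} {p : M.Group → Prop} (one : p 1)
    (step : ∀ x ∈ X, ∀ w ∈ WP M X, len M (M.simple x * w) = len M w + 1 → p w → p (M.simple x * w))
    {w : M.Group} (hw : w ∈ WP M X) : p w := by
  obtain ⟨ω, h1, h2, rfl⟩ := WP_word M hw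
  clear hw
  induction ω with
  | nil => exact one
  | cons s ω ih =>
    have h3 : ∀ x ∈ ω, x ∈ X := fun x hx => h1 x (by simp [hx])
    have h4 := len_wp_le M ω
    rw [wp_cons] at h2 ⊢
    simp only [List.length_cons] at h2
    have h5 : len M (M.simple s * wp M ω) = len M (wp M ω) + 1 := by
      rcases len_simple_mul M s (wp M ω) with h | h <;> omega
    exact step s (h1 s (by simp)) _ (wp_mem_WP M ω h3) h5 (ih h3 (by omega))

lemma simple_mem_WP_iff {X : Set B} {x : B} : M.simple x ∈ WP M X ↔ x ∈ X := by
  refine ⟨fun h => ?_, simple_mem_WP M⟩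
  obtain ⟨ω, h1, h2, h3⟩ := WP_word M h
  rw [len_simple] at h2
  obtain ⟨y, rfl⟩ := List.length_eq_one_iff.mp h2
  rw [wp_cons, wp_nil, mul_one] at h3
  rw [← simple_inj M h3]; exact h1 y (by simp)

lemma len_eq_one_mem {X : Set B} {w : M.Group} (hw : w ∈ WP M X) (h : len M w = 1) :
    ∃ x ∈ X, w = M.simple x := by
  obtain ⟨ω, h1, h2, h3⟩ := WP_word M hw
  rw [h] at h2
  obtain ⟨y, rfl⟩ := List.length_eq_one_iff.mp h2
  rw [wp_cons, wp_nil, mul_one] at h3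
  exact ⟨y, h1 y (by simp), h3.symm⟩

/-- left minimal with respect to `Z` -/
def lmin (Z : Set B) (v : M.Group) : Prop := ∀ z ∈ Z, len M (M.simple z * v) = len M v + 1
/-- right minimal with respect to `X` -/
def rmin (X : Set B) (w : M.Group) : Prop := ∀ x ∈ X, len M (w * M.simple x) = len M w + 1

lemma rmin_inv {X : Set B} {w : M.Group} : rmin M X w ↔ lmin M X w⁻¹ := by
  have : ∀ x, len M (w * M.simple x) = len M (M.simple x * w⁻¹) := by
    intro x
    rw [← len_inv, mul_inv_rev, sim_inv]
  simp only [rmin, lmin, len_inv, this]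

lemma len_add_of_global {Z : Set B} {v : M.Group} (hv : ∀ t ∈ WP M Z, len M v ≤ len M (t * v))
    {u : M.Group} (hu : u ∈ WP M Z) : len M (u * v) = len M u + len M v := by
  refine WP_induction M (p := fun u => len M (u * v) = len M u + len M v) ?_ ?_ hu
  · simp [len_one]
  · intro z hz u hu hlen ih
    rw [mul_assoc, hlen]
    have h1 := (NN_eq_zero_iff M z u).2 hlen
    have h2 : NN M (u * v) (M.simple z) = 0 := by
      rw [NN_mul, Pi.add_apply, h1, zero_add, cact]
      by_contra h3
      have h4 := len_lt_of_NN M h3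
      have h5 := hv (u⁻¹ * M.simple z * u) (mul_mem (mul_mem (inv_mem hu) (simple_mem_WP M hz)) hu)
      omega
    rw [NN_eq_zero_iff] at h2
    omega

lemma exists_global (Z : Set B) (w : M.Group) : ∃ u ∈ WP M Z, ∃ v, w = u * v ∧
    ∀ t ∈ WP M Z, len M v ≤ len M (t * v) := by
  classical
  have hne : ∃ n, ∃ u ∈ WP M Z, len M (u * w) = n := ⟨_, 1, one_mem _, rfl⟩
  obtain ⟨u, hu, h⟩ := Nat.find_spec hne
  refine ⟨u⁻¹, inv_mem hu, u * w, by group, fun t ht => ?_⟩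
  rw [h, ← mul_assoc]
  exact Nat.find_min' hne ⟨t * u, mul_mem ht hu, rfl⟩

lemma lmin_global {Z : Set B} {v : M.Group} (hv : lmin M Z v) :
    ∀ t ∈ WP M Z, len M v ≤ len M (t * v) := by
  obtain ⟨u, hu, v0, h1, h2⟩ := exists_global M Z v
  by_cases h : u = 1
  · rw [h, one_mul] at h1; rwa [h1]
  · exfalso
    obtain ⟨ω, h3, h4, h5⟩ := WP_word M hu
    cases ω with
    | nil => exact h h5.symm
    | cons z ω =>
      have h6 : wp M ω ∈ WP M Z := wp_mem_WP M ω fun x hx => h3 x (by simp [hx])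
      have h7 := hv z (h3 z (by simp))
      rw [h1, len_add_of_global M h2 hu, ← h5, wp_cons, mul_assoc, sim_cancel,
        len_add_of_global M h2 h6, ← wp_cons, h5, ← h4] at h7
      have := len_wp_le M ω
      simp at h7
      omega

lemma len_add {Z : Set B} {u v : M.Group} (hu : u ∈ WP M Z) (hv : lmin M Z v) :
    len M (u * v) = len M u + len M v := len_add_of_global M (lmin_global M hv) hu

lemma exists_lmin (Z : Set B) (w : M.Group) : ∃ u ∈ WP M Z, ∃ v, w = u * v ∧ lmin M Z v := by
  obtain ⟨u, hu, v, h1, h2⟩ := exists_global M Z w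
  refine ⟨u, hu, v, h1, fun z hz => ?_⟩
  have := h2 _ (simple_mem_WP M hz)
  rcases len_simple_mul M z v with h | h <;> omega

lemma lmin_unique {Z : Set B} {u u' v v' : M.Group} (hu : u ∈ WP M Z) (hu' : u' ∈ WP M Z)
    (hv : lmin M Z v) (hv' : lmin M Z v') (h : u * v = u' * v') : u = u' ∧ v = v' := by
  have h1 : v' = (u'⁻¹ * u) * v := by rw [mul_assoc, h]; group
  have h2 : v = (u'⁻¹ * u)⁻¹ * v' := by rw [h1]; group
  have hm : u'⁻¹ * u ∈ WP M Z := mul_mem (inv_mem hu') hu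
  have h3 := len_add M hm hv
  have h4 := len_add M (inv_mem hm) hv'
  rw [← h1] at h3
  rw [← h2] at h4
  have h5 : len M (u'⁻¹ * u) = 0 := by omega
  rw [len_eq_zero, inv_mul_eq_one] at h5
  subst h5
  exact ⟨rfl, mul_left_cancel h⟩

lemma len_add_right {X : Set B} {w v : M.Group} (hw : rmin M X w) (hv : v ∈ WP M X) :
    len M (w * v) = len M w + len M v := by
  rw [← len_inv, mul_inv_rev, len_add M (inv_mem hv) ((rmin_inv M).1 hw), len_inv, len_inv, add_comm]

lemma rmin_unique {X : Set B} {w w' v v' : M.Group} (hv : v ∈ WP M X) (hv' : v' ∈ WP M X)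
    (hw : rmin M X w) (hw' : rmin M X w') (h : w * v = w' * v') : w = w' ∧ v = v' := by
  have := lmin_unique M (inv_mem hv) (inv_mem hv') ((rmin_inv M).1 hw) ((rmin_inv M).1 hw')
    (by rw [← mul_inv_rev, h, mul_inv_rev])
  exact ⟨inv_injective this.2, inv_injective this.1⟩

/-- folding condition -/
lemma folding {s x : B} {w : M.Group} (h1 : len M (M.simple s * w) = len M w + 1)
    (h2 : len M (w * M.simple x) = len M w + 1)
    (h3 : len M (M.simple s * w * M.simple x) ≠ len M w + 2) : M.simple s * w = w * M.simple x := by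
  have h4 : NN M (w * M.simple x) (M.simple s) ≠ 0 := by
    rw [NN_ne_iff, ← mul_assoc]
    rcases len_mul_simple M (M.simple s * w) x with h | h <;> omega
  rw [NN_mul, Pi.add_apply, (NN_eq_zero_iff M s w).2 h1, zero_add, cact, NN_simple] at h4
  have h5 : w⁻¹ * M.simple s * w = M.simple x := by
    by_contra h; exact h4 (delta_ne h)
  rw [← h5]; group

lemma deodhar {X : Set B} {s : B} {w : M.Group} (hw : rmin M X w)
    (h : ∀ x ∈ X, M.simple s * w ≠ w * M.simple x) : rmin M X (M.simple s * w) := by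
  intro x hx
  rcases len_simple_mul M s w with h1 | h1
  · have := fun h3 => h x hx (folding M h1 (hw x hx) h3)
    rw [not_imp_comm] at this
    by_contra h2
    exact h2 (by rw [this (by tauto), h1])
  · have h2 := hw x hx
    rcases len_mul_simple M (M.simple s * w) x with h3 | h3
    · exact h3
    · exfalso
      have h4 := len_mul_le M (M.simple s) (M.simple s * w * M.simple x)
      rw [mul_assoc, sim_cancel, len_simple, ← mul_assoc] at h4
      omega

end Len

section Dihedral
variable {B : Type*} (M : CoxeterMatrix B)

lemma altProd_two_mul {G : Type*} [Monoid G] (a b : G) (n : ℕ) : altProd a b (2 * n) = (a * b) ^ n := by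
  induction n with
  | zero => simp [altProd_zero]
  | succ n ih =>
    rw [show 2 * (n + 1) = 2 * n + 1 + 1 by ring, altProd_succ, altProd_succ, ih, pow_succ', mul_assoc]

lemma len_altProd_le (s t : B) (n : ℕ) : len M (altProd (M.simple s) (M.simple t) n) ≤ n := by
  induction n generalizing s t with
  | zero => simp [altProd_zero, len_one]
  | succ n ih =>
    rw [altProd_succ]
    have h1 := len_mul_le M (M.simple s) (altProd (M.simple t) (M.simple s) n)
    have h2 := ih t s
    rw [len_simple] at h1
    omega

lemma len_altProd {s t : B} (hst : s ≠ t) {n : ℕ} (hn : M s t = 0 ∨ n ≤ M s t) :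
    len M (altProd (M.simple s) (M.simple t) n) = n := by
  induction n generalizing s t with
  | zero => simp [altProd_zero, len_one]
  | succ n ih =>
    have h1 := ih (s := t) (t := s) hst.symm (by rw [M.symmetric t s]; omega)
    rw [altProd_succ]
    have h2 : NN M (altProd (M.simple t) (M.simple s) n) (M.simple s) = 0 := by
      rw [NN, map_altProd, linkW_simple, linkW_simple,
        altProd_rho _ _ (sim_mul_self M t) (sim_mul_self M s), cact_zero, add_zero, Finset.sum_apply]
      apply Finset.sum_eq_zero
      intro i hi
      apply delta_ne
      intro h
      rw [Finset.mem_range] at hi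
      have h3 : (M.simple t * M.simple s) ^ (i + 1) = 1 := by
        rw [pow_succ, ← mul_assoc, ← h, sim_mul_self]
      have h4 := order_dvd M h3
      rw [M.symmetric t s] at h4
      have h5 := Nat.le_of_dvd (by omega) h4
      rcases hn with hn | hn
      · rw [hn] at h4; simp at h4
      · omega
    rw [NN_eq_zero_iff] at h2
    omega

lemma dihedral_alt {s t : B} {u : M.Group} (hu : u ∈ WP M ({s, t} : Set B))
    (hd : len M (M.simple s * u) + 1 = len M u ) :
    u = altProd (M.simple s) (M.simple t) (len M u) := by
  -- every element is alternating
  have key : ∀ n : ℕ, ∀ s t : B, ∀ u ∈ WP M ({s, t} : Set B), len M u = n + 1 →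
      len M (M.simple s * u) + 1 = len M u → u = altProd (M.simple s) (M.simple t) (n + 1) := by
    intro n
    induction n with
    | zero =>
      intro s t u hu h1 h2
      have h3 : M.simple s * u = 1 := by rw [← len_eq_zero M]; omega
      rw [altProd_succ, altProd_zero, mul_one]
      rw [← sim_inv]; exact (inv_eq_of_mul_eq_one_right h3).symm
    | succ n ih =>
      intro s t u hu h1 h2
      have hv : M.simple s * u ∈ WP M ({s, t} : Set B) :=
        mul_mem (simple_mem_WP M (by simp)) hu
      obtain ⟨ω, h3, h4, h5⟩ := WP_word M hv
      cases ω with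
      | nil => simp at h4; omega
      | cons z ω =>
        have h6 : len M (M.simple z * (M.simple s * u)) + 1 = len M (M.simple s * u) := by
          rw [← h5, wp_cons, sim_cancel, ← wp_cons, h5]
          have := len_wp_le M ω
          have h7 := len_simple_mul M z (wp M ω)
          rw [← wp_cons, h5] at h7
          simp at h4; omega
        have hz := h3 z (by simp)
        rcases hz with rfl | hz
        · rw [sim_cancel] at h6; omega
        · rw [Set.mem_singleton_iff] at hz
          subst hz
          have := ih z s (M.simple s * u) (by rwa [Set.pair_comm]) (by omega) h6
          rw [altProd_succ, ← this, sim_cancel]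
  have := key (len M u - 1) s t u hu (by omega) hd
  rwa [show len M u - 1 + 1 = len M u by omega] at this

lemma two_descents {s t : B} {w : M.Group}
    (hs : len M (M.simple s * w) + 1 = len M w) (ht : len M (M.simple t * w) + 1 = len M w) :
    M s t ≠ 0 ∧ ∃ v, w = altProd (M.simple s) (M.simple t) (M s t) * v ∧
      len M w = M s t + len M v := by
  obtain ⟨u, hu, v, rfl, hv⟩ := exists_lmin M ({s, t} : Set B) w
  have hsu : M.simple s * u ∈ WP M ({s, t} : Set B) := mul_mem (simple_mem_WP M (by simp)) hu
  have htu : M.simple t * u ∈ WP M ({s, t} : Set B) := mul_mem (simple_mem_WP M (by simp)) hu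
  rw [← mul_assoc, len_add M hsu hv, len_add M hu hv] at hs
  rw [← mul_assoc, len_add M htu hv, len_add M hu hv] at ht
  have h1 := dihedral_alt M hu (by omega)
  have h2 := dihedral_alt M (s := t) (t := s) (by rwa [Set.pair_comm]) (u := u) (by omega)
  set k := len M u with hk
  have h3 : (M.simple s * M.simple t) ^ k = 1 := by
    rw [← altProd_mul_inv _ _ (sim_mul_self M s) (sim_mul_self M t), ← h1, ← h2, mul_inv_cancel]
  have h4 := order_dvd M h3
  have hk0 : 0 < k := by omega
  have hm0 : M s t ≠ 0 := by
    intro h; rw [h] at h4; simp at h4; omega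
  have hkm : k = M s t := by
    obtain ⟨c, hc⟩ := h4
    have hc0 : c ≠ 0 := by rintro rfl; simp at hc; omega
    by_cases hc1 : c = 1
    · rw [hc, hc1, mul_one]
    exfalso
    have h5 : 2 * M s t ≤ k := by
      rw [hc, mul_comm]; exact Nat.mul_le_mul_left _ (by omega)
    obtain ⟨j, hj⟩ := Nat.exists_eq_add_of_le h5
    rw [hj, altProd_add, altProd_two_mul, sim_pow, one_mul, if_pos (by simp)] at h1
    have := len_altProd_le M s t j
    rw [← h1, ← hk] at this
    omega
  refine ⟨hm0, v, ?_, ?_⟩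
  · rw [← hkm, ← h1]
  · rw [len_add M hu hv, ← hk, hkm]

end Dihedral
end ArtinTits

namespace ArtinTits
section Matsumoto
variable {B : Type*} (M : CoxeterMatrix B)

def altw (s t : B) : ℕ → List B
  | 0 => []
  | n + 1 => s :: altw t s n

lemma altw_length (s t : B) (n : ℕ) : (altw s t n).length = n := by
  induction n generalizing s t with
  | zero => rfl
  | succ n ih => simp [altw, ih]

lemma altw_prod {G : Type*} [Monoid G] (f : B → G) (s t : B) (n : ℕ) :
    ((altw s t n).map f).prod = altProd (f s) (f t) n := by
  induction n generalizing s t with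
  | zero => rfl
  | succ n ih => simp [altw, ih, altProd_succ]

def wpA (ω : List B) : ArtinGroup M := (ω.map (σ M)).prod

lemma wpA_nil : wpA M [] = 1 := rfl
lemma wpA_cons (s : B) (ω : List B) : wpA M (s :: ω) = σ M s * wpA M ω := by simp [wpA]
lemma wpA_append (ω ω' : List B) : wpA M (ω ++ ω') = wpA M ω * wpA M ω' := by simp [wpA]

lemma pr_wpA (ω : List B) : pr M (wpA M ω) = wp M ω := by
  induction ω with
  | nil => simp [wpA_nil, wp_nil]
  | cons s ω ih => rw [wpA_cons, wp_cons, map_mul, pr_σ, ih]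

theorem matsumoto (n : ℕ) : ∀ ω ω' : List B, ω.length = n → ω'.length = n → wp M ω = wp M ω' →
    len M (wp M ω) = n → wpA M ω = wpA M ω' := by
  induction n with
  | zero =>
    intro ω ω' h1 h2 _ _
    rw [List.length_eq_zero_iff] at h1 h2
    rw [h1, h2]
  | succ n ih =>
    intro ω ω' h1 h2 h3 h4
    obtain ⟨s, ω, rfl⟩ := List.exists_cons_of_length_eq_add_one h1
    obtain ⟨t, ω', rfl⟩ := List.exists_cons_of_length_eq_add_one h2
    simp only [List.length_cons, Nat.add_right_cancel_iff] at h1 h2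
    set w := wp M (s :: ω) with hw
    have es : M.simple s * w = wp M ω := by rw [hw, wp_cons, sim_cancel]
    have et : M.simple t * w = wp M ω' := by rw [h3, wp_cons, sim_cancel]
    have ls : len M (M.simple s * w) + 1 = len M w := by
      have := len_wp_le M ω
      rcases len_simple_mul M s w with h | h
      · rw [es] at h; omega
      · exact h
    have lt : len M (M.simple t * w) + 1 = len M w := by
      have := len_wp_le M ω'
      rcases len_simple_mul M t w with h | h
      · rw [et] at h; omega
      · exact h
    obtain ⟨hm, v, hv, hl⟩ := two_descents M ls lt
    obtain ⟨m, hm'⟩ := Nat.exists_eq_succ_of_ne_zero hm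
    obtain ⟨ν, n1, n2⟩ := exists_word M v
    have hv2 : w = altProd (M.simple t) (M.simple s) (M s t) * v := by
      rw [← altProd_eq_of_pow (sim_mul_self M s) (sim_mul_self M t) (sim_pow M s t)]; exact hv
    have w1 : ∀ a b : B, wp M (altw a b m ++ ν) = altProd (M.simple a) (M.simple b) m * v := by
      intro a b; rw [wp_append, n2]; congr 1; exact altw_prod _ _ _ _
    have w2 : ∀ a b : B, wpA M (altw a b m ++ ν) = altProd (σ M a) (σ M b) m * wpA M ν := by
      intro a b; rw [wpA_append]; congr 1; exact altw_prod _ _ _ _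
    have i1 : wpA M ω = wpA M (altw t s m ++ ν) := by
      apply ih _ _ h1
      · rw [List.length_append, altw_length]; omega
      · rw [← es, hv, hm', altProd_succ, w1, mul_assoc, sim_cancel]
      · rw [← es]; omega
    have i2 : wpA M ω' = wpA M (altw s t m ++ ν) := by
      apply ih _ _ h2
      · rw [List.length_append, altw_length]; omega
      · rw [← et, hv2, hm', altProd_succ, w1, mul_assoc, sim_cancel]
      · rw [← et]; omega
    rw [wpA_cons, wpA_cons, i1, i2, w2, w2, ← mul_assoc, ← mul_assoc, ← altProd_succ, ← altProd_succ,
      ← Nat.succ_eq_add_one, ← hm', artin_braid M s t hm]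

/-- the canonical (set-theoretic) section of `pr` -/
noncomputable def tau (w : M.Group) : ArtinGroup M := wpA M (exists_word M w).choose

lemma tau_word {w : M.Group} (ω : List B) (h : ω.length = len M w) (hw : wp M ω = w) :
    tau M w = wpA M ω := by
  obtain ⟨h1, h2⟩ := (exists_word M w).choose_spec
  exact matsumoto M (len M w) _ _ h1 h (h2.trans hw.symm) (by rw [h2])

lemma tau_mul {u v : M.Group} (h : len M (u * v) = len M u + len M v) :
    tau M (u * v) = tau M u * tau M v := by
  obtain ⟨ω, h1, h2⟩ := exists_word M u
  obtain ⟨ν, h3, h4⟩ := exists_word M v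
  rw [tau_word M ω h1 h2, tau_word M ν h3 h4, ← wpA_append]
  apply tau_word
  · rw [List.length_append, h, h1, h3]
  · rw [wp_append, h2, h4]

lemma tau_one : tau M 1 = 1 := tau_word M [] (by simp [len_one]) rfl

lemma tau_simple (s : B) : tau M (M.simple s) = σ M s := by
  rw [tau_word M [s] (by simp [len_simple]) (by simp [wp_cons, wp_nil])]
  simp [wpA_cons, wpA_nil]

lemma pr_tau (w : M.Group) : pr M (tau M w) = w := by
  obtain ⟨ω, h1, h2⟩ := exists_word M w
  rw [tau_word M ω h1 h2, pr_wpA, h2]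

lemma σ_mem {X : Set B} {x : B} (hx : x ∈ X) : σ M x ∈ AP M X :=
  Subgroup.subset_closure ⟨x, hx, rfl⟩

lemma tau_mem {X : Set B} {w : M.Group} (hw : w ∈ WP M X) : tau M w ∈ AP M X := by
  obtain ⟨ω, h1, h2, h3⟩ := WP_word M hw
  rw [tau_word M ω h2 h3]
  apply Subgroup.list_prod_mem
  intro a ha
  obtain ⟨x, hx, rfl⟩ := List.mem_map.1 ha
  exact σ_mem M (h1 x hx)

lemma pr_mem {X : Set B} {g : ArtinGroup M} (hg : g ∈ AP M X) : pr M g ∈ WP M X := by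
  induction hg using Subgroup.closure_induction with
  | mem y hy =>
    obtain ⟨x, hx, rfl⟩ := hy
    rw [pr_σ]; exact simple_mem_WP M hx
  | one => rw [map_one]; exact one_mem _
  | mul a b _ _ ha hb => rw [map_mul]; exact mul_mem ha hb
  | inv a _ ha => rw [map_inv]; exact inv_mem ha

lemma tau_conj {s x : B} {w : M.Group} (h : M.simple s * w = w * M.simple x) :
    σ M s * tau M w = tau M w * σ M x := by
  have up : ∀ w : M.Group, M.simple s * w = w * M.simple x →
      len M (M.simple s * w) = len M w + 1 → σ M s * tau M w = tau M w * σ M x := by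
    intro w h h1
    rw [← tau_simple, ← tau_simple, ← tau_mul, ← tau_mul, h]
    · rw [← h, h1, len_simple]
    · rw [h1, len_simple, add_comm]
  rcases len_simple_mul M s w with h1 | h1
  · exact up w h h1
  · have h2 := up (M.simple s * w) (by rw [sim_cancel, h, sim_cancel_right]) (by rw [sim_cancel, h1])
    have h3 : tau M w = σ M s * tau M (M.simple s * w) := by
      conv_lhs => rw [← sim_cancel M s w]
      rw [tau_mul, tau_simple]
      rw [sim_cancel, len_simple]; omega
    rw [h3, mul_assoc, ← h2]

end Matsumoto
end ArtinTits

namespace ArtinTits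
section Forward
variable {B : Type*} (M : CoxeterMatrix B)

lemma lk_one : lk M 1 = 0 := by simp [lk]

lemma lk_mul_pure {g h : ArtinGroup M} (hg : pr M g = 1) : lk M (g * h) = lk M g + lk M h := by
  rw [lk_mul, hg, cact_one]

lemma pure_pow (y : B) (k : ℕ) : pr M ((σ M y * σ M y) ^ k) = 1 ∧
    lk M ((σ M y * σ M y) ^ k) = (2 * k : ℤ) • delta ℤ (M.simple y) := by
  have h0 : pr M (σ M y * σ M y) = 1 := by rw [map_mul, pr_σ, sim_mul_self]
  induction k with
  | zero => simp [lk_one]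
  | succ k ih =>
    rw [pow_succ]
    refine ⟨by rw [map_mul, ih.1, h0, one_mul], ?_⟩
    rw [lk_mul_pure M ih.1, ih.2, lk_mul, lk_σ, pr_σ, cact_delta, mul_inv_cancel_right]
    push_cast
    module

noncomputable def pureEl (idx : B → ℕ) (l : List B) : ArtinGroup M :=
  (l.map fun y => (σ M y * σ M y) ^ (idx y + 1)).prod

lemma pureEl_spec (idx : B → ℕ) (l : List B) (hl : l.Nodup) : pr M (pureEl M idx l) = 1 ∧
    (∀ z ∈ l, lk M (pureEl M idx l) (M.simple z) = 2 * (idx z + 1)) ∧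
    (∀ t, (∀ z ∈ l, t ≠ M.simple z) → lk M (pureEl M idx l) t = 0) := by
  induction l with
  | nil => simp [pureEl, lk_one]
  | cons y l ih =>
    obtain ⟨hy, hl⟩ := List.nodup_cons.1 hl
    obtain ⟨i1, i2, i3⟩ := ih hl
    have e : pureEl M idx (y :: l) = (σ M y * σ M y) ^ (idx y + 1) * pureEl M idx l := by
      simp [pureEl]
    obtain ⟨p1, p2⟩ := pure_pow M y (idx y + 1)
    have e2 : ∀ t, lk M (pureEl M idx (y :: l)) t =
        (2 * (idx y + 1) : ℤ) * delta ℤ (M.simple y) t + lk M (pureEl M idx l) t := by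
      intro t
      rw [e, lk_mul_pure M p1, p2]; simp
    refine ⟨by rw [e, map_mul, p1, i1, one_mul], ?_, ?_⟩
    · intro z hz
      rw [e2]
      by_cases hzy : z = y
      · subst hzy
        rw [delta_self, i3]
        · simp
        · intro x hx h
          exact hy (by rwa [simple_inj M h])
      · rw [delta_ne (fun h => hzy (simple_inj M h)), i2 z (by simpa [hzy] using hz)]
        simp
    · intro t ht
      rw [e2, delta_ne (ht y (by simp)), i3 t (fun z hz => ht z (by simp [hz]))]
      simp

theorem starW_of_stable [Finite B] (X : Set B) (hs : IsConjugacyStable (AP M X)) : StarW M X := by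
  classical
  intro Y₁ Y₂ hY₁ hY₂ w hw
  obtain ⟨n, ⟨en⟩⟩ := Finite.exists_equiv_fin B
  set idx : B → ℕ := fun b => (en b : ℕ) with hidx
  have idx_inj : Function.Injective idx := fun a b h => en.injective (Fin.ext h)
  have hfin : Y₁.Finite := Set.toFinite _
  set l := hfin.toFinset.toList with hl
  have hmem : ∀ z, z ∈ l ↔ z ∈ Y₁ := by intro z; simp [hl]
  have hnd : l.Nodup := Finset.nodup_toList _
  obtain ⟨p1, p2, p3⟩ := pureEl_spec M idx l hnd
  set a := pureEl M idx l with ha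
  set g := tau M w with hg
  have hconj : ∀ y ∈ Y₁, ∃ x ∈ X, σ M y * g = g * σ M x := by
    intro y hy
    have : w⁻¹ * M.simple y * w ∈ M.simple '' Y₂ := by
      rw [← hw]; exact ⟨_, ⟨y, hy, rfl⟩, rfl⟩
    obtain ⟨x, hx, hxe⟩ := this
    exact ⟨x, hY₂ hx, tau_conj M (by rw [hxe]; group)⟩
  have haX : a ∈ AP M X := by
    apply Subgroup.list_prod_mem
    intro b hb
    obtain ⟨y, hy, rfl⟩ := List.mem_map.1 hb
    have := σ_mem M (hY₁ ((hmem y).1 hy))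
    exact pow_mem (mul_mem this this) _
  have hbX : g⁻¹ * a * g ∈ AP M X := by
    have : g⁻¹ * a * g = (MulAut.conj g⁻¹) a := by simp
    rw [this, ha, pureEl, map_list_prod]
    apply Subgroup.list_prod_mem
    intro b hb
    rw [List.map_map] at hb
    obtain ⟨y, hy, rfl⟩ := List.mem_map.1 hb
    obtain ⟨x, hx, hxe⟩ := hconj y ((hmem y).1 hy)
    have e : (MulAut.conj g⁻¹) (σ M y) = σ M x := by
      simp only [MulAut.conj_apply, inv_inv]
      rw [mul_assoc, hxe]; group
    simp only [Function.comp_apply, map_pow, map_mul, e]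
    exact pow_mem (mul_mem (σ_mem M hx) (σ_mem M hx)) _
  obtain ⟨h, hh, he⟩ := hs a _ haX hbX ⟨g, rfl⟩
  refine ⟨pr M h, pr_mem M hh, fun y hy => ?_⟩
  have hcomm : (g * h⁻¹) * a = a * (g * h⁻¹) := by
    have : h⁻¹ * a * h * h⁻¹ = g⁻¹ * a * g * h⁻¹ := by rw [he]
    calc (g * h⁻¹) * a = g * (h⁻¹ * a * h * h⁻¹) := by group
      _ = _ := by rw [this]; group
  have hlk := congrArg (lk M) hcomm
  rw [lk_mul, lk_mul_pure M p1, add_comm, add_right_cancel_iff] at hlk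
  have hk : pr M (g * h⁻¹) = w * (pr M h)⁻¹ := by rw [map_mul, map_inv, hg, pr_tau]
  rw [hk] at hlk
  set v := pr M h with hv
  have h1 := congrFun hlk (M.simple y)
  rw [p2 y ((hmem y).2 hy), cact] at h1
  have h2 : ∃ z ∈ l, (w * v⁻¹)⁻¹ * M.simple y * (w * v⁻¹) = M.simple z := by
    by_contra hcon
    push Not at hcon
    rw [p3 _ hcon] at h1
    omega
  obtain ⟨z, hz, hze⟩ := h2
  rw [hze, p2 z hz] at h1
  have h3 : z = y := idx_inj (by omega)
  subst h3
  have : v * (w⁻¹ * M.simple z * w) * v⁻¹ = M.simple z := by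
    conv_rhs => rw [← hze]
    group
  conv_lhs => rw [← this]
  group

end Forward
end ArtinTits

namespace ArtinTits
section Retract
variable {B : Type*} (M : CoxeterMatrix B) (X : Set B)

lemma NN_inv_conj (p t : M.Group) : NN M p⁻¹ (p⁻¹ * t * p) = NN M p t := by
  have h := congrFun (NN_mul M p⁻¹ p) (p⁻¹ * t * p)
  rw [inv_mul_cancel, NN_one, Pi.add_apply, cact,
    show p⁻¹⁻¹ * (p⁻¹ * t * p) * p⁻¹ = t by group, Pi.zero_apply] at h
  generalize NN M p⁻¹ (p⁻¹ * t * p) = a at *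
  generalize NN M p t = b at *
  revert a b; decide

lemma NN_inv_simple_mul (s : B) (p t : M.Group) : NN M (M.simple s * p)⁻¹ t =
    NN M p⁻¹ t + delta (ZMod 2) (p⁻¹ * M.simple s * p) t := by
  rw [mul_inv_rev, sim_inv, NN_mul, NN_simple, cact_delta, inv_inv]; rfl

lemma NN_inv_mono {s : B} {p u : M.Group} (h : len M (M.simple s * p) = len M p + 1)
    (hu : NN M p⁻¹ u ≠ 0) : NN M (M.simple s * p)⁻¹ u ≠ 0 := by
  rw [NN_inv_simple_mul, delta_ne, add_zero]
  · exact hu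
  · rintro rfl
    rw [NN_inv_conj] at hu
    exact hu ((NN_eq_zero_iff M s p).2 h)

/-- `s` is a loop at `w` -/
def Loop (s : B) (w : M.Group) : Prop := ∃ x ∈ X, M.simple s * w = w * M.simple x

open Classical in
noncomputable def nx (s : B) (w : M.Group) : M.Group := if Loop M X s w then w else M.simple s * w

open Classical in
noncomputable def cc (s : B) (w : M.Group) : ArtinGroup M :=
  if h : Loop M X s w then σ M h.choose else 1

variable {X}
lemma nx_loop {s : B} {w : M.Group} (h : Loop M X s w) : nx M X s w = w := if_pos h
lemma nx_not {s : B} {w : M.Group} (h : ¬ Loop M X s w) : nx M X s w = M.simple s * w := if_neg h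
lemma cc_not {s : B} {w : M.Group} (h : ¬ Loop M X s w) : cc M X s w = 1 := dif_neg h
lemma cc_loop {s x : B} {w : M.Group} (hx : x ∈ X) (h : M.simple s * w = w * M.simple x) :
    cc M X s w = σ M x := by
  have hl : Loop M X s w := ⟨x, hx, h⟩
  rw [cc, dif_pos hl]
  congr 1
  apply simple_inj M
  apply mul_left_cancel (a := w)
  exact hl.choose_spec.2.symm.trans h

lemma loop_simple_mul {s : B} {w : M.Group} : Loop M X s (M.simple s * w) ↔ Loop M X s w := by
  unfold Loop
  constructor
  · rintro ⟨x, hx, h⟩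
    refine ⟨x, hx, ?_⟩
    rw [sim_cancel] at h
    conv_rhs => rw [h]
    rw [sim_cancel_right]
  · rintro ⟨x, hx, h⟩
    refine ⟨x, hx, ?_⟩
    rw [sim_cancel, h, sim_cancel_right]

lemma nx_nx (s : B) (w : M.Group) : nx M X s (nx M X s w) = w := by
  by_cases h : Loop M X s w
  · rw [nx_loop M h, nx_loop M h]
  · rw [nx_not M h, nx_not M (by rwa [loop_simple_mul]), sim_cancel]

lemma cc_nx (s : B) (w : M.Group) : cc M X s (nx M X s w) = cc M X s w := by
  by_cases h : Loop M X s w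
  · rw [nx_loop M h]
  · rw [nx_not M h, cc_not M h, cc_not M (by rwa [loop_simple_mul])]

lemma nx_rmin {s : B} {w : M.Group} (hw : rmin M X w) : rmin M X (nx M X s w) := by
  by_cases h : Loop M X s w
  · rwa [nx_loop M h]
  · rw [nx_not M h]
    exact deodhar M hw (fun x hx he => h ⟨x, hx, he⟩)

lemma cc_mem (s : B) (w : M.Group) : cc M X s w ∈ AP M X := by
  by_cases h : Loop M X s w
  · obtain ⟨x, hx, he⟩ := h
    rw [cc_loop M hx he]; exact σ_mem M hx
  · rw [cc_not M h]; exact one_mem _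

variable (X)
abbrev Om : Type _ := {w : M.Group // rmin M X w} × ArtinGroup M

noncomputable def stp (s : B) : Equiv.Perm (Om M X) where
  toFun p := (⟨nx M X s p.1.1, nx_rmin M p.1.2⟩, cc M X s p.1.1 * p.2)
  invFun p := (⟨nx M X s p.1.1, nx_rmin M p.1.2⟩, (cc M X s p.1.1)⁻¹ * p.2)
  left_inv p := by
    obtain ⟨⟨w, hw⟩, a⟩ := p
    simp only [nx_nx, cc_nx, inv_mul_cancel_left]
  right_inv p := by
    obtain ⟨⟨w, hw⟩, a⟩ := p
    simp only [nx_nx, cc_nx, mul_inv_cancel_left]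

lemma stp_apply (s : B) (w : M.Group) (hw : rmin M X w) (a : ArtinGroup M) :
    stp M X s (⟨w, hw⟩, a) = (⟨nx M X s w, nx_rmin M hw⟩, cc M X s w * a) := rfl

lemma stp_word (ω : List B) (hω : len M (wp M ω) = ω.length) (w : M.Group) (hw : rmin M X w) :
    ∃ (w' v : M.Group) (hw' : rmin M X w'), v ∈ WP M X ∧ wp M ω * w = w' * v ∧
      (∀ a, (ω.map (stp M X)).prod (⟨w, hw⟩, a) = (⟨w', hw'⟩, tau M v * a)) ∧
      (∀ t, NN M v⁻¹ t ≠ 0 → NN M (wp M ω)⁻¹ (w * t * w⁻¹) ≠ 0) := by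
  induction ω with
  | nil =>
    refine ⟨w, 1, hw, one_mem _, by simp [wp_nil], ?_, ?_⟩
    · intro a; simp [tau_one]
    · intro t ht; simp [NN_one] at ht
  | cons s ω ih =>
    have hle := len_wp_le M ω
    rw [wp_cons, List.length_cons] at hω
    have hup : len M (M.simple s * wp M ω) = len M (wp M ω) + 1 := by
      rcases len_simple_mul M s (wp M ω) with h | h <;> omega
    obtain ⟨w', v, hw', hv, h1, h2, h3⟩ := ih (by omega)
    have hN0 := (NN_eq_zero_iff M s (wp M ω)).2 hup
    by_cases hl : Loop M X s w'
    · obtain ⟨x, hx, he⟩ := hl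
      have hconj : w * (v⁻¹ * M.simple x * v) * w⁻¹ = (wp M ω)⁻¹ * M.simple s * wp M ω := by
        have e1 : w * v⁻¹ = (wp M ω)⁻¹ * w' := by
          rw [eq_inv_mul_iff_mul_eq, ← mul_assoc, h1]; group
        have e2 : v * w⁻¹ = w'⁻¹ * wp M ω := by
          rw [eq_inv_mul_iff_mul_eq, ← mul_assoc, ← h1]; group
        calc w * (v⁻¹ * M.simple x * v) * w⁻¹ = (w * v⁻¹) * M.simple x * (v * w⁻¹) := by group
          _ = (wp M ω)⁻¹ * (w' * M.simple x) * w'⁻¹ * wp M ω := by rw [e1, e2]; group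
          _ = _ := by rw [← he]; group
      have hxv : len M (M.simple x * v) = len M v + 1 := by
        rw [← NN_eq_zero_iff]
        by_contra hne
        rw [← NN_inv_conj] at hne
        have := h3 _ hne
        rw [hconj, NN_inv_conj] at this
        exact this hN0
      refine ⟨w', M.simple x * v, hw', mul_mem (simple_mem_WP M hx) hv, ?_, ?_, ?_⟩
      · rw [wp_cons, mul_assoc, h1, ← mul_assoc, he, mul_assoc]
      · intro a
        rw [List.map_cons, List.prod_cons, Equiv.Perm.mul_apply, h2, stp_apply]
        have hloop : Loop M X s w' := ⟨x, hx, he⟩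
        rw [tau_mul M (by rw [hxv, len_simple, add_comm]), tau_simple, cc_loop M hx he]
        simp only [nx_loop M hloop, mul_assoc]
      · intro t ht
        rw [wp_cons]
        by_cases htx : t = v⁻¹ * M.simple x * v
        · rw [htx, hconj, NN_inv_simple_mul, NN_inv_conj, hN0, delta_self]; decide
        · rw [NN_inv_simple_mul, delta_ne htx, add_zero] at ht
          exact NN_inv_mono M hup (h3 t ht)
    · refine ⟨M.simple s * w', v, by rw [← nx_not M hl]; exact nx_rmin M hw', hv, ?_, ?_, ?_⟩
      · rw [wp_cons, mul_assoc, h1, mul_assoc]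
      · intro a
        rw [List.map_cons, List.prod_cons, Equiv.Perm.mul_apply, h2, stp_apply]
        simp only [nx_not M hl, cc_not M hl, one_mul]
      · intro t ht
        rw [wp_cons]
        exact NN_inv_mono M hup (h3 t ht)

lemma stp_braid (s t : B) (_ : M s t ≠ 0) :
    altProd (stp M X s) (stp M X t) (M s t) = altProd (stp M X t) (stp M X s) (M s t) := by
  by_cases hst : s = t
  · rw [hst]
  have e1 : len M (wp M (altw s t (M s t))) = (altw s t (M s t)).length := by
    rw [altw_length, wp, altw_prod, len_altProd M hst (Or.inr le_rfl)]
  have e2 : len M (wp M (altw t s (M s t))) = (altw t s (M s t)).length := by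
    rw [altw_length, wp, altw_prod, len_altProd M (Ne.symm hst) (Or.inr (by rw [M.symmetric t s]))]
  have e3 : wp M (altw s t (M s t)) = wp M (altw t s (M s t)) := by
    rw [wp, wp, altw_prod, altw_prod]
    exact altProd_eq_of_pow (sim_mul_self M s) (sim_mul_self M t) (sim_pow M s t)
  rw [← altw_prod, ← altw_prod]
  ext1 p
  obtain ⟨⟨w, hw⟩, a⟩ := p
  obtain ⟨w1, v1, hw1, hv1, a1, b1, -⟩ := stp_word M X _ e1 w hw
  obtain ⟨w2, v2, hw2, hv2, a2, b2, -⟩ := stp_word M X _ e2 w hw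
  rw [b1, b2]
  obtain ⟨rfl, rfl⟩ := rmin_unique M hv1 hv2 hw1 hw2 (by rw [← a1, ← a2, e3])
  rfl

noncomputable def act : ArtinGroup M →* Equiv.Perm (Om M X) :=
  artinLift M (stp M X) (stp_braid M X)

lemma act_σ (s : B) (w : M.Group) (hw : rmin M X w) (a : ArtinGroup M) :
    act M X (σ M s) (⟨w, hw⟩, a) = (⟨nx M X s w, nx_rmin M hw⟩, cc M X s w * a) := by
  rw [act, artinLift_σ, stp_apply]

lemma act_σ_inv (s : B) (w : M.Group) (hw : rmin M X w) (a : ArtinGroup M) :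
    act M X (σ M s)⁻¹ (⟨w, hw⟩, a) = (⟨nx M X s w, nx_rmin M hw⟩, (cc M X s w)⁻¹ * a) := by
  rw [map_inv, act, artinLift_σ]; rfl

lemma act_right (g : ArtinGroup M) (p : Om M X) (b : ArtinGroup M) :
    act M X g (p.1, p.2 * b) = ((act M X g p).1, (act M X g p).2 * b) := by
  induction g using artin_induction M with
  | one => simp
  | mul s g ih =>
    rw [map_mul, Equiv.Perm.mul_apply, Equiv.Perm.mul_apply, ih]
    obtain ⟨⟨w, hw⟩, a⟩ := act M X g p
    rw [act_σ, act_σ]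
    simp only [mul_assoc]
  | inv s g ih =>
    rw [map_mul, Equiv.Perm.mul_apply, Equiv.Perm.mul_apply, ih]
    obtain ⟨⟨w, hw⟩, a⟩ := act M X g p
    rw [act_σ_inv, act_σ_inv]
    simp only [mul_assoc]

lemma act_mem (g : ArtinGroup M) (p : Om M X) (hp : p.2 ∈ AP M X) :
    (act M X g p).2 ∈ AP M X := by
  induction g using artin_induction M with
  | one => simpa
  | mul s g ih =>
    rw [map_mul, Equiv.Perm.mul_apply]
    generalize act M X g p = q at *
    obtain ⟨⟨w, hw⟩, a⟩ := q
    rw [act_σ]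
    exact mul_mem (cc_mem M _ _) ih
  | inv s g ih =>
    rw [map_mul, Equiv.Perm.mul_apply]
    generalize act M X g p = q at *
    obtain ⟨⟨w, hw⟩, a⟩ := q
    rw [act_σ_inv]
    exact mul_mem (inv_mem (cc_mem M _ _)) ih

lemma rmin_one : rmin M X 1 := by
  intro x _; rw [one_mul, len_simple, len_one]

lemma act_X {b : ArtinGroup M} (hb : b ∈ AP M X) (a : ArtinGroup M) :
    act M X b (⟨1, rmin_one M X⟩, a) = (⟨1, rmin_one M X⟩, b * a) := by
  induction hb using Subgroup.closure_induction generalizing a with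
  | mem y hy =>
    obtain ⟨x, hx, rfl⟩ := hy
    have he : M.simple x * 1 = 1 * M.simple x := by simp
    rw [act_σ, cc_loop M hx he]
    simp only [nx_loop M ⟨x, hx, he⟩]
  | one => simp
  | mul g h _ _ ih1 ih2 => rw [map_mul, Equiv.Perm.mul_apply, ih2, ih1, mul_assoc]
  | inv g _ ih =>
    rw [map_inv, Equiv.Perm.inv_eq_iff_eq, ih, mul_inv_cancel_left]

end Retract
end ArtinTits

namespace ArtinTits
section Backward
variable {B : Type*} (M : CoxeterMatrix B) (X : Set B)

lemma AP_mono {Y Z : Set B} (h : Y ⊆ Z) : AP M Y ≤ AP M Z :=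
  Subgroup.closure_mono (Set.image_mono h)

lemma loop_conj {Z : Set B} {w u : M.Group} (hw : rmin M X w) (hl : lmin M Z w)
    (hu : u ∈ WP M Z) {z x : B} (hz : z ∈ Z) (hx : x ∈ X)
    (he : M.simple z * (u * w) = u * w * M.simple x) :
    ∃ y ∈ Z, Loop M X y w ∧ (tau M w)⁻¹ * σ M y * tau M w = σ M x := by
  have ht : u⁻¹ * M.simple z * u ∈ WP M Z := mul_mem (mul_mem (inv_mem hu) (simple_mem_WP M hz)) hu
  have h1 : (u⁻¹ * M.simple z * u) * w = w * M.simple x := by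
    calc (u⁻¹ * M.simple z * u) * w = u⁻¹ * (M.simple z * (u * w)) := by group
      _ = _ := by rw [he]; group
  have h2 := len_add M ht hl
  rw [h1, hw x hx] at h2
  obtain ⟨y, hy, hye⟩ := len_eq_one_mem M ht (by omega)
  rw [hye] at h1
  refine ⟨y, hy, ⟨x, hx, h1⟩, ?_⟩
  rw [mul_assoc, tau_conj M h1, inv_mul_cancel_left]

lemma act_invariant {Z : Set B} {w : M.Group} (hw : rmin M X w) (hl : lmin M Z w)
    {c : ArtinGroup M} (hc : c ∈ AP M Z) :
    ∃ u ∈ WP M Z, ∃ k ∈ AP M {z ∈ Z | Loop M X z w}, ∃ huw : rmin M X (u * w),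
      act M X c (⟨w, hw⟩, 1) = (⟨u * w, huw⟩, (tau M w)⁻¹ * k * tau M w) := by
  induction hc using Subgroup.closure_induction_left with
  | one =>
    refine ⟨1, one_mem _, 1, one_mem _, by simpa using hw, by simp⟩
  | mul_left x hx g _ ih =>
    obtain ⟨z, hz, rfl⟩ := hx
    obtain ⟨u, hu, k, hk, huw, e⟩ := ih
    rw [map_mul, Equiv.Perm.mul_apply, e, act_σ]
    by_cases h : Loop M X z (u * w)
    · obtain ⟨x, hx, he⟩ := id h
      obtain ⟨y, hy, hyl, hye⟩ := loop_conj M X hw hl hu hz hx he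
      refine ⟨u, hu, σ M y * k, mul_mem (σ_mem M ⟨hy, hyl⟩) hk, huw, ?_⟩
      rw [cc_loop M hx he]
      simp only [nx_loop M h, ← hye]
      congr 1
      group
    · refine ⟨M.simple z * u, mul_mem (simple_mem_WP M hz) hu, k, hk, ?_, ?_⟩
      · rw [mul_assoc, ← nx_not M h]; exact nx_rmin M huw
      · simp only [nx_not M h, cc_not M h, one_mul, mul_assoc]
  | inv_mul_cancel x hx g _ ih =>
    obtain ⟨z, hz, rfl⟩ := hx
    obtain ⟨u, hu, k, hk, huw, e⟩ := ih
    rw [map_mul, Equiv.Perm.mul_apply, e, act_σ_inv]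
    by_cases h : Loop M X z (u * w)
    · obtain ⟨x, hx, he⟩ := id h
      obtain ⟨y, hy, hyl, hye⟩ := loop_conj M X hw hl hu hz hx he
      refine ⟨u, hu, (σ M y)⁻¹ * k, mul_mem (inv_mem (σ_mem M ⟨hy, hyl⟩)) hk, huw, ?_⟩
      rw [cc_loop M hx he]
      simp only [nx_loop M h, ← hye]
      congr 1
      group
    · refine ⟨M.simple z * u, mul_mem (simple_mem_WP M hz) hu, k, hk, ?_, ?_⟩
      · rw [mul_assoc, ← nx_not M h]; exact nx_rmin M huw
      · simp only [nx_not M h, cc_not M h, inv_one, one_mul, mul_assoc]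

lemma act_all_loop {Z : Set B} {w : M.Group} (hw : rmin M X w) (hl : ∀ z ∈ Z, Loop M X z w)
    {c : ArtinGroup M} (hc : c ∈ AP M Z) :
    act M X c (⟨w, hw⟩, 1) = (⟨w, hw⟩, (tau M w)⁻¹ * c * tau M w) := by
  induction hc using Subgroup.closure_induction_left with
  | one => simp
  | mul_left x hx g _ ih =>
    obtain ⟨z, hz, rfl⟩ := hx
    rw [map_mul, Equiv.Perm.mul_apply, ih, act_σ]
    obtain ⟨x, hx, he⟩ := hl z hz
    have hye : (tau M w)⁻¹ * σ M z * tau M w = σ M x := by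
      rw [mul_assoc, tau_conj M he, inv_mul_cancel_left]
    rw [cc_loop M hx he]
    simp only [nx_loop M (hl z hz), ← hye]
    congr 1
    group
  | inv_mul_cancel x hx g _ ih =>
    obtain ⟨z, hz, rfl⟩ := hx
    rw [map_mul, Equiv.Perm.mul_apply, ih, act_σ_inv]
    obtain ⟨x, hx, he⟩ := hl z hz
    have hye : (tau M w)⁻¹ * σ M z * tau M w = σ M x := by
      rw [mul_assoc, tau_conj M he, inv_mul_cancel_left]
    rw [cc_loop M hx he]
    simp only [nx_loop M (hl z hz), ← hye]
    congr 1
    group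

lemma conj_eq_on {Z : Set B} {g h : ArtinGroup M}
    (H : ∀ z ∈ Z, g⁻¹ * σ M z * g = h⁻¹ * σ M z * h) {c : ArtinGroup M} (hc : c ∈ AP M Z) :
    g⁻¹ * c * g = h⁻¹ * c * h := by
  have e : ∀ g c : ArtinGroup M, g⁻¹ * c * g = MulAut.conj g⁻¹ c := by intro g c; simp
  simp only [e] at H ⊢
  induction hc using Subgroup.closure_induction with
  | mem x hx => obtain ⟨z, hz, rfl⟩ := hx; exact H z hz
  | one => simp only [map_one]
  | mul a b _ _ ha hb => rw [map_mul, map_mul, ha, hb]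
  | inv a _ ha => rw [map_inv (MulAut.conj g⁻¹) a, map_inv (MulAut.conj h⁻¹) a, ha]

lemma conj_into_min (hstar : StarW M X) {Z : Set B} (hZX : Z ⊆ X) {a c g : ArtinGroup M}
    (ha : a ∈ AP M X) (hc : c ∈ AP M Z) (hg : c * g = g * a)
    (hmin : ∀ Y ⊆ Z, (∃ k ∈ AP M Y, ∃ q, k * q = q * a) → Z ⊆ Y) :
    ∃ h ∈ AP M X, c * h = h * a := by
  classical
  have hne : ∃ n, ∃ g' d : ArtinGroup M, d ∈ AP M Z ∧ (d * c * d⁻¹) * g' = g' * a ∧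
      len M (act M X g' (⟨1, rmin_one M X⟩, 1)).1.1 = n :=
    ⟨_, g, 1, one_mem _, by simpa using hg, rfl⟩
  obtain ⟨g', d, hd, hcg, hn⟩ := Nat.find_spec hne
  have hfm := fun k => Nat.find_min' hne (m := k)
  generalize Nat.find hne = n at *
  have hp : (act M X g' (⟨1, rmin_one M X⟩, 1)).2 ∈ AP M X := act_mem M X _ _ (one_mem _)
  obtain ⟨⟨⟨w, hw⟩, p⟩, hwp⟩ : ∃ q, act M X g' (⟨1, rmin_one M X⟩, 1) = q := ⟨_, rfl⟩
  rw [hwp] at hp hn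
  simp only at hp hn
  set c' := d * c * d⁻¹ with hc'
  have hcZ : c' ∈ AP M Z := mul_mem (mul_mem hd hc) (inv_mem hd)
  have hl : lmin M Z w := by
    intro z hz
    rcases len_simple_mul M z w with h | h
    · exact h
    · exfalso
      have hnl : ¬ Loop M X z w := by
        rintro ⟨x, hx, he⟩
        have := hw x hx
        rw [← he] at this; omega
      have := hfm (len M (M.simple z * w)) ⟨σ M z * g', σ M z * d, mul_mem (σ_mem M hz) hd, ?_, ?_⟩
      · omega
      · calc σ M z * d * c * (σ M z * d)⁻¹ * (σ M z * g') = σ M z * (d * c * d⁻¹ * g') := by group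
          _ = _ := by rw [hcg]; group
      · rw [map_mul, Equiv.Perm.mul_apply, hwp, act_σ]
        simp only [nx_not M hnl]
  -- the action of `c'` on `(w, 1)`
  have hk1 : act M X c' (⟨w, hw⟩, p) = (⟨w, hw⟩, p * a) := by
    rw [← hwp, ← Equiv.Perm.mul_apply, ← map_mul, hcg, map_mul, Equiv.Perm.mul_apply,
      act_X M X ha]
    have := act_right M X g' (⟨1, rmin_one M X⟩, 1) a
    rw [hwp] at this
    simpa using this
  have hk2 : act M X c' (⟨w, hw⟩, 1) = (⟨w, hw⟩, p * a * p⁻¹) := by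
    have := act_right M X c' (⟨w, hw⟩, p) p⁻¹
    rw [hk1] at this
    simpa using this
  obtain ⟨u, hu, k, hk, huw, e⟩ := act_invariant M X hw hl hcZ
  have hκ : p * a * p⁻¹ = (tau M w)⁻¹ * k * tau M w := by
    rw [hk2] at e; exact congrArg Prod.snd e
  have hall : ∀ z ∈ Z, Loop M X z w := by
    have := hmin {z ∈ Z | Loop M X z w} (Set.sep_subset _ _) ⟨k, hk, tau M w * p, ?_⟩
    · intro z hz; exact (this hz).2
    · calc k * (tau M w * p) = tau M w * ((tau M w)⁻¹ * k * tau M w) * p := by group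
        _ = _ := by rw [← hκ]; group
  have hκ2 : p * a * p⁻¹ = (tau M w)⁻¹ * c' * tau M w := by
    rw [act_all_loop M X hw hall hcZ] at hk2
    exact (congrArg Prod.snd hk2).symm
  obtain ⟨v, hv, hvz⟩ := hstar Z {x ∈ X | ∃ z ∈ Z, M.simple z * w = w * M.simple x} hZX
    (Set.sep_subset _ _) w (by
      ext t
      constructor
      · rintro ⟨_, ⟨z, hz, rfl⟩, rfl⟩
        obtain ⟨x, hx, he⟩ := hall z hz
        exact ⟨x, ⟨hx, z, hz, he⟩, by simp only [mul_assoc]; rw [he, inv_mul_cancel_left]⟩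
      · rintro ⟨x, ⟨hx, z, hz, he⟩, rfl⟩
        exact ⟨_, ⟨z, hz, rfl⟩, by simp only [mul_assoc]; rw [he, inv_mul_cancel_left]⟩)
  have hconj : (tau M w)⁻¹ * c' * tau M w = (tau M v)⁻¹ * c' * tau M v := by
    apply conj_eq_on M _ hcZ
    intro z hz
    obtain ⟨x, hx, he⟩ := hall z hz
    have he' : M.simple z * v = v * M.simple x := by
      have h1 := hvz z hz
      rw [mul_assoc w⁻¹, he, inv_mul_cancel_left] at h1
      rw [← h1]; group
    rw [mul_assoc, tau_conj M he, mul_assoc, tau_conj M he', inv_mul_cancel_left,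
      inv_mul_cancel_left]
  rw [hconj] at hκ2
  refine ⟨d⁻¹ * tau M v * p, mul_mem (mul_mem (inv_mem (AP_mono M hZX hd)) (tau_mem M hv)) hp, ?_⟩
  calc c * (d⁻¹ * tau M v * p) = d⁻¹ * tau M v * ((tau M v)⁻¹ * (d * c * d⁻¹) * tau M v) * p := by
        group
    _ = _ := by rw [← hc', ← hκ2]; group

theorem stable_of_starW [Finite B] (hstar : StarW M X) : IsConjugacyStable (AP M X) := by
  rintro a b ha hb ⟨g, rfl⟩
  let S : Set (Set B) := {Z | Z ⊆ X ∧ ∃ k ∈ AP M Z, ∃ q, k * q = q * a}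
  obtain ⟨Z, ⟨hZX, c, hc, q, hq⟩, hmin⟩ := WellFounded.has_min
    (wellFounded_lt (α := Set B)) S ⟨X, subset_rfl, a, ha, 1, by simp⟩
  have hmin' : ∀ Y ⊆ Z, (∃ k ∈ AP M Y, ∃ q, k * q = q * a) → Z ⊆ Y := by
    intro Y hY hk
    by_contra hn
    exact hmin Y ⟨hY.trans hZX, hk⟩ ⟨hY, hn⟩
  obtain ⟨h1, hh1, e1⟩ := conj_into_min M X hstar hZX ha hc hq hmin'
  obtain ⟨h2, hh2, e2⟩ := conj_into_min M X hstar hZX hb hc (g := q * g)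
    (by rw [← mul_assoc, hq]; group)
    (by
      rintro Y hY ⟨k, hk, r, hr⟩
      refine hmin' Y hY ⟨k, hk, r * g⁻¹, ?_⟩
      rw [← mul_assoc, hr]; group)
  refine ⟨h1⁻¹ * h2, mul_mem (inv_mem hh1) hh2, ?_⟩
  have e3 : h1 * a * h1⁻¹ = c := by rw [← e1]; group
  calc (h1⁻¹ * h2)⁻¹ * a * (h1⁻¹ * h2) = h2⁻¹ * (h1 * a * h1⁻¹) * h2 := by group
    _ = h2⁻¹ * (c * h2) := by rw [e3]; group
    _ = _ := by rw [e2]; group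

end Backward
end ArtinTits



namespace ArtinTits

/-- Final remark of the paper: for an irreducible Artin–Tits group of spherical type, `A_X` is
conjugacy stable in `A_S` if and only if `(W_X, W_S)` satisfies Property `⋆_W`. -/
theorem conjugacy_stable_iff_starW
    {B : Type*} [Finite B] (M : CoxeterMatrix B) [Finite M.Group]
    (hconn : ConnectedIn M Set.univ)
    (X : Set B) (hX : X.Nonempty) (hXproper : X ≠ Set.univ) :
    IsConjugacyStable (AP M X) ↔ StarW M X := by
  exact ⟨fun h => starW_of_stable M X h, fun h => stable_of_starW M X h⟩

end ArtinTits
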